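/- arXiv:0812.0022 — 2 statements merged into one kernel-verified Lean document; each statement's English description precedes it below -/
import Mathlib

section
/- One-step intertwining in the geometric-jump case (core of Theorem 4.1): for every n ≥ 1 and all q_1,…,q_{n+1} ∈ (0,1), for every y ∈ W^{n+1} and every (x′,y′) ∈ W^{n,n+1}, one has m(x′,y′) · p_Y(y,y′) = Σ_{x ∈ W^n : x ⪯ y} m(x,y) · q((x,y),(x′,y′)). -/
open scoped BigOperators

noncomputable section

/-- Sum of the entries of an integer vector. -/
def vsum {n : ℕ} (z : Fin n → ℤ) : ℤ := ∑ i, z i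

/-- `Interlace x y` means `x ⪯ y`, i.e. `y_i ≤ x_i ≤ y_{i+1}` for `1 ≤ i ≤ n`. -/
def Interlace {n : ℕ} (x : Fin n → ℤ) (y : Fin (n + 1) → ℤ) : Prop :=
  ∀ i : Fin n, y i.castSucc ≤ x i ∧ x i ≤ y i.succ

/-- `PrecEq x x'` means `x ≺ x'`: `x_1 ≤ x'_1 ≤ x_2 ≤ x'_2 ≤ … ≤ x_n ≤ x'_n`. -/
def PrecEq {k : ℕ} (x x' : Fin k → ℤ) : Prop :=
  (∀ i, x i ≤ x' i) ∧ ∀ (i : ℕ) (h : i + 1 < k), x' ⟨i, Nat.lt_of_succ_lt h⟩ ≤ x ⟨i + 1, h⟩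

/-- `p` encodes an integer Gelfand–Tsetlin pattern with rows `1, …, n`. -/
def IsGT (n : ℕ) (p : ℕ → ℕ → ℤ) : Prop :=
  (∀ k i, 1 ≤ k → k < n → i < k → p (k + 1) i ≤ p k i ∧ p k i ≤ p (k + 1) (i + 1)) ∧
  (∀ r i, r = 0 ∨ n < r ∨ r ≤ i → p r i = 0)

/-- `|x^r|`, the sum of the entries of row `r`. -/
def rowSum (p : ℕ → ℕ → ℤ) (r : ℕ) : ℤ := ∑ i ∈ Finset.range r, p r i

/-- The geometric weight `w^q(x) = ∏_{i=1}^n q_i^{|x^i| - |x^{i-1}|}` (0-based rates). -/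
def wGT (n : ℕ) (q : ℕ → ℝ) (p : ℕ → ℕ → ℤ) : ℝ :=
  ∏ k ∈ Finset.range n, q k ^ (rowSum p (k + 1) - rowSum p k)

/-- `K_n(z)`: the Gelfand–Tsetlin patterns with bottom row `z`. -/
def GTset (n : ℕ) (z : Fin n → ℤ) : Set (ℕ → ℕ → ℤ) :=
  {p | IsGT n p ∧ ∀ i : Fin n, p n i = z i}

/-- The Schur function `S_z(q_1, …, q_n)`. -/
def Schur (n : ℕ) (q : ℕ → ℝ) (z : Fin n → ℤ) : ℝ :=
  ∑ᶠ p ∈ GTset n z, wGT n q p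

/-- The "blocking" factor `b(u,v) = (1−q)·1{v < u} + 1{u = v}`. -/
def bfactor (q : ℝ) (u v : ℤ) : ℝ :=
  (1 - q) * (if v < u then 1 else 0) + (if u = v then 1 else 0)

/-- The "pushing" factor `c(u,v) = q^{−v}·1{u ≤ v} + q^{−u}·1{u > v}`. -/
def cfactor (q : ℝ) (u v : ℤ) : ℝ :=
  q ^ (-v) * (if u ≤ v then 1 else 0) + q ^ (-u) * (if v < u then 1 else 0)

/-- The conditional probability factor
`r(y′,x′,x,y) = q_{n+1}^{y′_1−y_1} b(x_1,y′_1) ·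
[∏_{i=2}^n q_{n+1}^{y′_i} b(x_i,y′_i) c(x′_{i−1},y_i)] ·
q_{n+1}^{y′_{n+1}} (1−q_{n+1}) c(x′_n, y_{n+1})`, here with `n+1` points in `x`. -/
def rfactor (n : ℕ) (qv : ℝ) (y' : Fin (n + 2) → ℤ) (x' : Fin (n + 1) → ℤ)
    (x : Fin (n + 1) → ℤ) (y : Fin (n + 2) → ℤ) : ℝ :=
  qv ^ (y' 0 - y 0) * bfactor qv (x 0) (y' 0) *
    (∏ j ∈ Finset.univ.filter (fun j : Fin (n + 1) => 1 ≤ j.val),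
      qv ^ (y' j.castSucc) * bfactor qv (x j) (y' j.castSucc) *
        cfactor qv (x' ⟨j.val - 1, lt_of_le_of_lt (Nat.sub_le _ _) j.isLt⟩) (y j.castSucc)) *
    (qv ^ (y' (Fin.last (n + 1))) * (1 - qv) * cfactor qv (x' (Fin.last n)) (y (Fin.last (n + 1))))

open Classical in
/-- The one-step transition kernel `q((x,y),(x′,y′))` of the coupled chain on `W^{n,n+1}`. -/
def qker (n : ℕ) (q : ℕ → ℝ) (x : Fin (n + 1) → ℤ) (y : Fin (n + 2) → ℤ)
    (x' : Fin (n + 1) → ℤ) (y' : Fin (n + 2) → ℤ) : ℝ :=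
  if PrecEq x x' ∧ PrecEq y y' ∧ Interlace x y ∧ Interlace x' y' then
    rfactor n (q (n + 1)) y' x' x y * (∏ i ∈ Finset.range (n + 1), (1 - q i)) *
      Schur (n + 1) q x' / Schur (n + 1) q x
  else 0

open Classical in
/-- The transition kernel `p_Y(y,y′) = a(q̃) S_{y′}(q̃)/S_y(q̃) · 1{y ≺ y′}` on `W^{n+1}`. -/
def pYker (n : ℕ) (q : ℕ → ℝ) (y y' : Fin (n + 2) → ℤ) : ℝ :=
  if PrecEq y y' then
    (∏ i ∈ Finset.range (n + 2), (1 - q i)) * Schur (n + 2) q y' / Schur (n + 2) q y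
  else 0

/-- `m(x,y) = q_{n+1}^{|y|−|x|} S_x(q)/S_y(q̃)`. -/
def mGeo (n : ℕ) (q : ℕ → ℝ) (x : Fin (n + 1) → ℤ) (y : Fin (n + 2) → ℤ) : ℝ :=
  q (n + 1) ^ (vsum y - vsum x) * Schur (n + 1) q x / Schur (n + 2) q y

theorem bfactor_ne_zero_imp_le {θ : ℝ} {u v : ℤ} (h : bfactor θ u v ≠ 0) : v ≤ u := by
  by_contra! hlt
  exact h (by simp [bfactor, hlt.not_gt, hlt.ne])

theorem cfactor_eq_zpow_neg_max (θ : ℝ) (u v : ℤ) : cfactor θ u v = θ ^ (-max u v) := by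
  rcases le_or_gt u v with h | h
  · simp [cfactor, h, h.not_gt]
  · simp [cfactor, h, h.not_ge, max_eq_left h.le]

/-- The telescoping sum of the blocking factors. -/
theorem sum_Icc_zpow_neg_mul_bfactor {θ : ℝ} (hθ : θ ≠ 0) {a M : ℤ} (h : a ≤ M) :
    ∑ k ∈ Finset.Icc a M, θ ^ (-k) * bfactor θ k a = θ ^ (-M) := by
  induction M, h using Int.leInduction with
  | base => simp [bfactor]
  | succ m hm ih =>
    have hIcc : Finset.Icc a (m + 1) = insert (m + 1) (Finset.Icc a m) := by
      ext k
      simp only [Finset.mem_Icc, Finset.mem_insert]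
      omega
    have hpow : θ ^ (-m) = θ * θ ^ (-(m + 1)) := by
      rw [← zpow_one_add₀ hθ]
      congr 1
      ring
    have hb : bfactor θ (m + 1) a = 1 - θ := by
      have h₁ : a < m + 1 := by omega
      simp [bfactor, h₁, h₁.ne']
    rw [hIcc, Finset.sum_insert (by simp), ih, hb, hpow]
    ring

theorem zpow_sum {ι : Type*} {θ : ℝ} (hθ : θ ≠ 0) (s : Finset ι) (f : ι → ℤ) :
    θ ^ (∑ i ∈ s, f i) = ∏ i ∈ s, θ ^ f i := by
  classical
  induction s using Finset.induction_on with
  | empty => simp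
  | insert a s ha ih => rw [Finset.sum_insert ha, Finset.prod_insert ha, zpow_add₀ hθ, ih]

theorem rfactor_eq {n : ℕ} {θ : ℝ} (hθ : θ ≠ 0) (y' : Fin (n + 2) → ℤ)
    (x' x : Fin (n + 1) → ℤ) (y : Fin (n + 2) → ℤ) :
    rfactor n θ y' x' x y =
      (1 - θ) * θ ^ (vsum y' - y 0) * (∏ j, bfactor θ (x j) (y' j.castSucc)) *
        ∏ j, cfactor θ (x' j) (y j.succ) := by
  have hsum : vsum y' = y' 0 + ((∑ j : Fin n, y' j.succ.castSucc) + y' (Fin.last (n + 1))) := by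
    rw [vsum, Fin.sum_univ_castSucc, Fin.sum_univ_succ]
    simp [add_assoc]
  have hexp : vsum y' - y 0 =
      (y' 0 - y 0) + ((∑ j : Fin n, y' j.succ.castSucc) + y' (Fin.last (n + 1))) := by
    rw [hsum]
    ring
  rw [hexp, zpow_add₀ hθ, zpow_add₀ hθ, zpow_sum hθ, Fin.prod_univ_succ,
    Fin.prod_univ_castSucc (fun j => cfactor θ (x' j) (y j.succ)), rfactor, Finset.prod_filter,
    Fin.prod_univ_succ]
  have hidx : ∀ j : Fin n, (⟨j.val, Nat.lt_succ_of_lt j.isLt⟩ : Fin (n + 1)) = j.castSucc :=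
    fun _ => rfl
  simp only [Fin.val_zero, Fin.val_succ, Nat.le_add_left, if_true, Nat.add_sub_cancel, hidx,
    Finset.prod_mul_distrib, Fin.castSucc_zero, Fin.succ_last, Fin.succ_castSucc,
    nonpos_iff_eq_zero, one_ne_zero, if_false]
  ring

/-- Every entry of a Gelfand–Tsetlin pattern is bounded in terms of its bottom row. -/
theorem abs_le_of_mem_GTset {n : ℕ} {z : Fin n → ℤ} {p : ℕ → ℕ → ℤ} (hp : p ∈ GTset n z)
    (d : ℕ) : ∀ r i, r + d = n → i < r → |p r i| ≤ ∑ j, |z j| := by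
  induction d with
  | zero =>
    rintro r i rfl hi
    rw [show p r i = z ⟨i, hi⟩ from hp.2 ⟨i, hi⟩]
    exact Finset.single_le_sum (f := fun j => |z j|) (fun j _ => abs_nonneg _)
      (Finset.mem_univ _)
  | succ d ih =>
    intro r i hr hi
    obtain ⟨h₁, h₂⟩ := hp.1.1 r i (by omega) (by omega) hi
    have h₃ := abs_le.1 (ih (r + 1) i (by omega) (by omega))
    have h₄ := abs_le.1 (ih (r + 1) (i + 1) (by omega) (by omega))
    exact abs_le.2 ⟨h₃.1.trans h₁, h₂.trans h₄.2⟩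

theorem GTset_finite (n : ℕ) (z : Fin n → ℤ) : (GTset n z).Finite := by
  set B : ℤ := ∑ j, |z j|
  have hB : 0 ≤ B := Finset.sum_nonneg fun _ _ => abs_nonneg _
  have hfin : (Set.univ.pi fun _ : Fin (n + 1) =>
      Set.univ.pi fun _ : Fin n => Set.Icc (-B) B).Finite :=
    Set.Finite.pi fun _ => Set.Finite.pi fun _ => Set.finite_Icc _ _
  refine Set.Finite.of_finite_image (f := fun p (r : Fin (n + 1)) (i : Fin n) => p r i)
    (hfin.subset ?_) ?_
  · rintro _ ⟨p, hp, rfl⟩ r - i -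
    change p r i ∈ Set.Icc (-B) B
    rw [Set.mem_Icc, ← abs_le]
    by_cases hi : (i : ℕ) < r
    · exact abs_le_of_mem_GTset hp (n - r) r i (by omega) hi
    · rw [hp.1.2 r i (by omega)]
      simpa using hB
  · intro p hp p' hp' h
    funext r i
    by_cases hri : r = 0 ∨ n < r ∨ r ≤ i
    · rw [hp.1.2 r i hri, hp'.1.2 r i hri]
    · exact congrFun (congrFun h ⟨r, by omega⟩) ⟨i, by omega⟩

theorem GTset_nonempty {n : ℕ} {z : Fin n → ℤ} (hz : Monotone z) : (GTset n z).Nonempty := by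
  refine ⟨fun r i => if h : i < r ∧ r ≤ n then z ⟨i, by omega⟩ else 0, ⟨?_, ?_⟩, ?_⟩
  · intro k i _ hk hi
    have h₁ : i < k + 1 ∧ k + 1 ≤ n := by omega
    have h₂ : i < k ∧ k ≤ n := by omega
    have h₃ : i + 1 < k + 1 ∧ k + 1 ≤ n := by omega
    simp only [h₁, h₂, h₃, and_self, dif_pos, le_refl, true_and]
    exact hz (by simp)
  · intro r i h
    exact dif_neg (by omega)
  · intro i
    exact dif_pos (by simp)

theorem Schur_pos {n : ℕ} {q : ℕ → ℝ} (hq : ∀ i, 0 < q i) {z : Fin n → ℤ} (hz : Monotone z) :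
    0 < Schur n q z := by
  rw [Schur, finsum_mem_eq_finite_toFinset_sum _ (GTset_finite n z)]
  refine Finset.sum_pos (fun p _ => Finset.prod_pos fun k _ => zpow_pos (hq k) _) ?_
  simpa using GTset_nonempty hz

/-- The rows `x` that can be blocked by `y'` and lie below `x'` and `y`. -/
def admissibleRows {n : ℕ} (x' : Fin (n + 1) → ℤ) (y y' : Fin (n + 2) → ℤ) :
    Finset (Fin (n + 1) → ℤ) :=
  Fintype.piFinset fun j => Finset.Icc (y' j.castSucc) (min (x' j) (y j.succ))

theorem mem_admissibleRows {n : ℕ} {x' x : Fin (n + 1) → ℤ} {y y' : Fin (n + 2) → ℤ} :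
    x ∈ admissibleRows x' y y' ↔ ∀ j, y' j.castSucc ≤ x j ∧ x j ≤ x' j ∧ x j ≤ y j.succ := by
  simp [admissibleRows]

theorem admissibleRows_spec {n : ℕ} {x' x : Fin (n + 1) → ℤ} {y y' : Fin (n + 2) → ℤ}
    (hxy' : Interlace x' y') (hyy' : PrecEq y y') (hx : x ∈ admissibleRows x' y y') :
    Monotone x ∧ Interlace x y ∧ PrecEq x x' := by
  rw [mem_admissibleRows] at hx
  have hstep : ∀ (i : ℕ) (h : i + 1 < n + 1),
      x' ⟨i, Nat.lt_of_succ_lt h⟩ ≤ x ⟨i + 1, h⟩ := fun i h =>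
    (hxy' ⟨i, Nat.lt_of_succ_lt h⟩).2.trans (hx ⟨i + 1, h⟩).1
  refine ⟨Fin.monotone_iff_le_succ.2 fun i => ?_, fun j => ⟨?_, (hx j).2.2⟩,
    fun j => (hx j).2.1, hstep⟩
  · exact (hx i.castSucc).2.1.trans (hstep i (by omega))
  · exact (hyy'.1 j.castSucc).trans (hx j).1

theorem sum_admissibleRows_mul_rfactor {n : ℕ} {θ : ℝ} (hθ : θ ≠ 0) {x' : Fin (n + 1) → ℤ}
    {y y' : Fin (n + 2) → ℤ} (hxy' : Interlace x' y') (hyy' : PrecEq y y') :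
    ∑ x ∈ admissibleRows x' y y', θ ^ (vsum y - vsum x) * rfactor n θ y' x' x y =
      (1 - θ) * θ ^ (vsum y' - vsum x') := by
  have hle : ∀ j : Fin (n + 1), y' j.castSucc ≤ min (x' j) (y j.succ) := fun j =>
    le_min (hxy' j).1 (hyy'.2 j (by omega))
  have hvsum : vsum y = y 0 + ∑ j : Fin (n + 1), y j.succ := Fin.sum_univ_succ _
  calc ∑ x ∈ admissibleRows x' y y', θ ^ (vsum y - vsum x) * rfactor n θ y' x' x y
      = (1 - θ) * θ ^ (vsum y' - y 0) * θ ^ vsum y * (∏ j, cfactor θ (x' j) (y j.succ)) *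
          ∑ x ∈ admissibleRows x' y y',
            ∏ j, θ ^ (-x j) * bfactor θ (x j) (y' j.castSucc) := by
        rw [Finset.mul_sum]
        refine Finset.sum_congr rfl fun x _ => ?_
        rw [rfactor_eq hθ, Finset.prod_mul_distrib, ← zpow_sum hθ, Finset.sum_neg_distrib,
          sub_eq_add_neg (vsum y), zpow_add₀ hθ]
        simp only [vsum]
        ring
    _ = (1 - θ) * θ ^ (vsum y' - y 0) * θ ^ vsum y *
          ∏ j, (θ ^ (-max (x' j) (y j.succ)) * θ ^ (-min (x' j) (y j.succ))) := by
        rw [admissibleRows, ← Finset.prod_univ_sum _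
          fun (j : Fin (n + 1)) k => θ ^ (-k) * bfactor θ k (y' j.castSucc), Finset.prod_mul_distrib]
        simp only [cfactor_eq_zpow_neg_max, sum_Icc_zpow_neg_mul_bfactor hθ (hle _)]
        ring
    _ = (1 - θ) * θ ^ (vsum y' - vsum x') := by
        have hprod : ∀ j, θ ^ (-max (x' j) (y j.succ)) * θ ^ (-min (x' j) (y j.succ)) =
            θ ^ (-(x' j + y j.succ)) := fun j => by
          rw [← zpow_add₀ hθ, ← neg_add, max_add_min]
        simp only [hprod]
        rw [← zpow_sum hθ, mul_assoc, mul_assoc, ← zpow_add₀ hθ, ← zpow_add₀ hθ,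
          Finset.sum_neg_distrib, Finset.sum_add_distrib, hvsum]
        congr 2
        simp only [vsum]
        ring

/-- One-step intertwining in the geometric-jump case:
`m(x′,y′)·p_Y(y,y′) = Σ_{x ⪯ y} m(x,y)·q((x,y),(x′,y′))`. -/
theorem geometric_one_step_intertwining (n : ℕ) (q : ℕ → ℝ)
    (hq : ∀ i, 0 < q i ∧ q i < 1)
    (y : Fin (n + 2) → ℤ) (hy : Monotone y)
    (x' : Fin (n + 1) → ℤ) (y' : Fin (n + 2) → ℤ)
    (hx' : Monotone x') (hy' : Monotone y') (hxy' : Interlace x' y') :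
    mGeo n q x' y' * pYker n q y y' =
      ∑ᶠ x ∈ {x : Fin (n + 1) → ℤ | Monotone x ∧ Interlace x y},
        mGeo n q x y * qker n q x y x' y' := by
  have hq₀ : ∀ i, 0 < q i := fun i => (hq i).1
  have hθ : q (n + 1) ≠ 0 := (hq₀ _).ne'
  by_cases hyy' : PrecEq y y'
  swap
  · simp [pYker, qker, hyy']
  have hsupp : {x : Fin (n + 1) → ℤ | Monotone x ∧ Interlace x y} ∩
        Function.support (fun x => mGeo n q x y * qker n q x y x' y') =
      (admissibleRows x' y y' : Set (Fin (n + 1) → ℤ)) ∩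
        Function.support (fun x => mGeo n q x y * qker n q x y x' y') := by
    ext x
    refine and_congr_left fun hne => ⟨fun hx => ?_, fun hx => ?_⟩
    · have hker : qker n q x y x' y' ≠ 0 := right_ne_zero_of_mul hne
      rw [qker] at hker
      split_ifs at hker with hcond
      swap
      · exact absurd rfl hker
      obtain ⟨hxx', -, hxy, -⟩ := hcond
      have hr : rfactor n (q (n + 1)) y' x' x y ≠ 0 := by
        intro h
        simp [h] at hker
      rw [rfactor_eq hθ] at hr
      have hb := Finset.prod_ne_zero_iff.1 (right_ne_zero_of_mul (left_ne_zero_of_mul hr))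
      exact Finset.mem_coe.2 (mem_admissibleRows.2 fun j =>
        ⟨bfactor_ne_zero_imp_le (hb j (Finset.mem_univ j)), hxx'.1 j, (hxy j).2⟩)
    · have h := admissibleRows_spec hxy' hyy' (Finset.mem_coe.1 hx)
      exact ⟨h.1, h.2.1⟩
  rw [finsum_mem_eq_sum_of_inter_support_eq _ hsupp]
  have hterm : ∀ x ∈ admissibleRows x' y y', mGeo n q x y * qker n q x y x' y' =
      (∏ i ∈ Finset.range (n + 1), (1 - q i)) * Schur (n + 1) q x' / Schur (n + 2) q y *
        (q (n + 1) ^ (vsum y - vsum x) * rfactor n (q (n + 1)) y' x' x y) := by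
    intro x hx
    obtain ⟨hmono, hxy, hxx'⟩ := admissibleRows_spec hxy' hyy' hx
    have hS : Schur (n + 1) q x ≠ 0 := (Schur_pos hq₀ hmono).ne'
    simp only [mGeo, qker, hxx', hyy', hxy, hxy', and_self, if_true]
    field_simp
  have hS' : Schur (n + 2) q y' ≠ 0 := (Schur_pos hq₀ hy').ne'
  rw [Finset.sum_congr rfl hterm, ← Finset.mul_sum, sum_admissibleRows_mul_rfactor hθ hxy' hyy',
    mGeo, pYker, if_pos hyy', Finset.prod_range_succ _ (n + 1)]
  field_simp

end
end

section
/- Intertwining with a wall, odd row to even row (core of Theorem 5.1): for every n ≥ 1 and every q = (q_1,…,q_n) ∈ (0,1)^n, for every y ∈ W_0^n and every (x′,y′) ∈ W_0^{n,n}, one has Q_{2n}(y,y′) · m(x′,y′) = Σ_{x ∈ W_0^n : x ≺ y} m(x,y) · A_0((x,y),(x′,y′)), i.e. Q_{2n} Λ = Λ A_0 where Λ(y,(x′,y′)) = m(x′,y′)·1{y′ = y}. -/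
open scoped BigOperators

noncomputable section

/-- Membership in `W₀^k = {0 ≤ z_1 ≤ z_2 ≤ ⋯ ≤ z_k}`. -/
def W0 {k : ℕ} (z : Fin k → ℤ) : Prop := Monotone z ∧ ∀ i, 0 ≤ z i

/-- `p` encodes an integer symplectic Gelfand–Tsetlin pattern with rows `1, …, n`,
row `r` having `⌈r/2⌉ = (r+1)/2` nonnegative entries `p r 0, …`; consecutive rows
satisfy `x^{2i-1} ≺ x^{2i}` and `x^{2i} ⪯ x^{2i+1}`; irrelevant entries are pinned to `0`. -/
def IsSymp (n : ℕ) (p : ℕ → ℕ → ℤ) : Prop :=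
  (∀ r i, 1 ≤ r → r ≤ n → i < (r + 1) / 2 → 0 ≤ p r i) ∧
  (∀ k, 1 ≤ k → 2 * k ≤ n →
    (∀ j, j < k → p (2 * k - 1) j ≤ p (2 * k) j) ∧
    (∀ j, j + 1 < k → p (2 * k) j ≤ p (2 * k - 1) (j + 1))) ∧
  (∀ k, 1 ≤ k → 2 * k + 1 ≤ n →
    (∀ j, j < k → p (2 * k + 1) j ≤ p (2 * k) j ∧ p (2 * k) j ≤ p (2 * k + 1) (j + 1))) ∧
  (∀ r i, r = 0 ∨ n < r ∨ (r + 1) / 2 ≤ i → p r i = 0)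

/-- `|x^r|`, the sum of the entries of row `r` (row `r` has `(r+1)/2` entries). -/
def rowSumS (p : ℕ → ℕ → ℤ) (r : ℕ) : ℤ := ∑ i ∈ Finset.range ((r + 1) / 2), p r i

/-- The geometric weight `w^q_n(x)`: each row `r` contributes
`q_{⌈r/2⌉}^{|x^r|−|x^{r−1}|}` if `r` is odd and `q_{r/2}^{−(|x^r|−|x^{r−1}|)}` if `r`
is even, which reproduces `w^q_{2k−1}` and `w^q_{2k}` (0-based rates). -/
def wSymp (n : ℕ) (q : ℕ → ℝ) (p : ℕ → ℕ → ℤ) : ℝ :=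
  ∏ r ∈ Finset.Icc 1 n,
    q ((r + 1) / 2 - 1) ^ ((if r % 2 = 1 then (1 : ℤ) else -1) * (rowSumS p r - rowSumS p (r - 1)))

/-- The symplectic Schur function `Sp^{2k−1}_z(q_1,…,q_k)`. -/
def SpOdd (k : ℕ) (q : ℕ → ℝ) (z : Fin k → ℤ) : ℝ :=
  ∑ᶠ p ∈ {p : ℕ → ℕ → ℤ | IsSymp (2 * k - 1) p ∧ ∀ i : Fin k, p (2 * k - 1) i = z i},
    wSymp (2 * k - 1) q p

/-- The symplectic Schur function `Sp^{2k}_z(q_1,…,q_k)`. -/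
def SpEven (k : ℕ) (q : ℕ → ℝ) (z : Fin k → ℤ) : ℝ :=
  ∑ᶠ p ∈ {p : ℕ → ℕ → ℤ | IsSymp (2 * k) p ∧ ∀ i : Fin k, p (2 * k) i = z i},
    wSymp (2 * k) q p

open Classical in
/-- The `Q`-matrix `Q_{2k−1}` on `W₀^k` (here `k = m+1`): jumps `x → x ± e_i` at rate
`Sp^{2k−1}_{x±e_i}(q)/Sp^{2k−1}_x(q)` whenever `x ± e_i ∈ W₀^k`, with diagonal
`−[Σ_{i=1}^{k−1}(q_i+q_i^{−1}) + q_k^{−1}·1{x_1>0} + q_k]`. -/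
def Qodd (m : ℕ) (q : ℕ → ℝ) (x x' : Fin (m + 1) → ℤ) : ℝ :=
  if x' = x then
    -((∑ i ∈ Finset.range m, (q i + (q i)⁻¹)) +
      (q m)⁻¹ * (if 0 < x 0 then 1 else 0) + q m)
  else if (∃ i, x' = x + Pi.single i 1 ∨ x' = x - Pi.single i 1) ∧ W0 x' then
    SpOdd (m + 1) q x' / SpOdd (m + 1) q x
  else 0

open Classical in
/-- The `Q`-matrix `Q_{2k}` on `W₀^k` (here `k = m+1`): jumps `x → x ± e_i` at rate
`Sp^{2k}_{x±e_i}(q)/Sp^{2k}_x(q)` whenever `x ± e_i ∈ W₀^k`, with diagonal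
`−Σ_{i=1}^{k}(q_i+q_i^{−1})`. -/
def Qeven (m : ℕ) (q : ℕ → ℝ) (x x' : Fin (m + 1) → ℤ) : ℝ :=
  if x' = x then -(∑ i ∈ Finset.range (m + 1), (q i + (q i)⁻¹))
  else if (∃ i, x' = x + Pi.single i 1 ∨ x' = x - Pi.single i 1) ∧ W0 x' then
    SpEven (m + 1) q x' / SpEven (m + 1) q x
  else 0

/-- `m(x,y) = q_n^{|x|−|y|} Sp^{2n−1}_x(q)/Sp^{2n}_y(q)` on `W₀^{n,n}` (here `n = m+1`). -/
def mOE (m : ℕ) (q : ℕ → ℝ) (x y : Fin (m + 1) → ℤ) : ℝ :=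
  q m ^ (vsum x - vsum y) * SpOdd (m + 1) q x / SpEven (m + 1) q y

open Classical in
/-- The `Q`-matrix `A₀` on `W₀^{n,n}` (here `n = m+1`), coupling an odd row `X`
evolving by `Q_{2n−1}` with an even row `Y`, with blocking and pushing. -/
def A0oe (m : ℕ) (q : ℕ → ℝ) (x y x' y' : Fin (m + 1) → ℤ) : ℝ :=
  if x' = x ∧ y' = y then
    -((∑ i ∈ Finset.range m, (q i + (q i)⁻¹)) + q m +
      (q m)⁻¹ * (if 0 < x 0 then 1 else 0) +
      (∑ i : Fin m, ((q m)⁻¹ * (if y i.castSucc < x i.succ then (1 : ℝ) else 0) +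
        q m * (if x i.castSucc < y i.castSucc then (1 : ℝ) else 0))) +
      q m * (if x (Fin.last m) < y (Fin.last m) then 1 else 0) + (q m)⁻¹)
  else if (∃ j, x' = x + Pi.single j 1 ∨ x' = x - Pi.single j 1) ∧ y' = y then
    Qodd m q x x'
  else if ∃ i : Fin m, x' = x - Pi.single i.succ 1 ∧ y' = y - Pi.single i.castSucc 1 ∧
      x i.succ = y i.castSucc then
    Qodd m q x x'
  else if ∃ j, x' = x + Pi.single j 1 ∧ y' = y + Pi.single j 1 ∧ x j = y j then
    Qodd m q x x'
  else if x' = x ∧ ∃ j, y' = y + Pi.single j 1 then (q m)⁻¹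
  else if x' = x ∧ ∃ j, y' = y - Pi.single j 1 then q m
  else 0

lemma IsSymp.le_of_top_le {n : ℕ} {p : ℕ → ℕ → ℤ} (hp : IsSymp n p) {B : ℤ}
    (hB : ∀ i, i < (n + 1) / 2 → p n i ≤ B) (d r i : ℕ) (hr : 1 ≤ r) (hd : r + d = n)
    (hi : i < (r + 1) / 2) : p r i ≤ B := by
  induction d generalizing r i with
  | zero =>
    obtain rfl : r = n := by omega
    exact hB i hi
  | succ d ih =>
    obtain ⟨-, h₁, h₂, -⟩ := hp
    obtain ⟨k, rfl | rfl⟩ := Nat.even_or_odd' r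
    · have h := (h₂ k (by omega) (by omega) i (by omega)).2
      exact h.trans (ih (2 * k + 1) (i + 1) (by omega) (by omega) (by omega))
    · have h := (h₁ (k + 1) (by omega) (by omega)).1 i (by omega)
      exact h.trans (ih (2 * (k + 1)) i (by omega) (by omega) (by omega))

lemma finite_symp {n k : ℕ} (hk : (n + 1) / 2 = k) (z : Fin k → ℤ) :
    {p : ℕ → ℕ → ℤ | IsSymp n p ∧ ∀ i : Fin k, p n i = z i}.Finite := by
  obtain ⟨B, hB⟩ : ∃ B, ∀ i, z i ≤ B :=
    ⟨∑ i, |z i|, fun i => (le_abs_self _).trans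
      (Finset.single_le_sum (f := fun i => |z i|) (fun _ _ => abs_nonneg _) (Finset.mem_univ i))⟩
  let N := n + 1
  have hfin : (Set.univ.pi fun _ : Fin N × Fin N => Set.Icc (0 : ℤ) (max 0 B)).Finite :=
    Set.Finite.pi fun _ => Set.finite_Icc _ _
  refine Set.Finite.of_injOn (f := fun p (a : Fin N × Fin N) => p a.1 a.2) ?_ ?_ hfin
  · rintro p ⟨hp, hz⟩ a -
    by_cases h : (a.1 : ℕ) = 0 ∨ n < a.1 ∨ ((a.1 : ℕ) + 1) / 2 ≤ a.2
    · simp [hp.2.2.2 _ _ h]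
    · push Not at h
      refine ⟨hp.1 _ _ (by omega) (by omega) (by omega), le_max_of_le_right ?_⟩
      refine hp.le_of_top_le (fun i hi => ?_) (n - a.1) _ _ (by omega) (by omega) h.2.2
      exact (hz ⟨i, by omega⟩).trans_le (hB _)
  · rintro p ⟨hp, -⟩ p' ⟨hp', -⟩ h
    ext r i
    by_cases hri : r = 0 ∨ n < r ∨ (r + 1) / 2 ≤ i
    · rw [hp.2.2.2 _ _ hri, hp'.2.2.2 _ _ hri]
    · push Not at hri
      exact congrFun h (⟨r, by omega⟩, ⟨i, by omega⟩)

/-- The pattern each of whose rows is an initial segment of `z`. -/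
def initialPattern {k : ℕ} (n : ℕ) (z : Fin k → ℤ) (r i : ℕ) : ℤ :=
  if h : i < k then (if r = 0 ∨ n < r ∨ (r + 1) / 2 ≤ i then 0 else z ⟨i, h⟩) else 0

lemma nonempty_symp {n k : ℕ} (hn : 1 ≤ n) (hk : (n + 1) / 2 = k) {z : Fin k → ℤ} (hz : W0 z) :
    {p : ℕ → ℕ → ℤ | IsSymp n p ∧ ∀ i : Fin k, p n i = z i}.Nonempty := by
  have hval : ∀ r i (h : i < k), 1 ≤ r → r ≤ n → i < (r + 1) / 2 →
      initialPattern n z r i = z ⟨i, h⟩ := by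
    intro r i h h₁ h₂ h₃
    have : ¬ (r = 0 ∨ n < r ∨ (r + 1) / 2 ≤ i) := by omega
    simp [initialPattern, h, this]
  refine ⟨initialPattern n z, ⟨fun r i h₁ h₂ h₃ => ?_, fun l h₁ h₂ => ⟨fun j hj => ?_, fun j hj => ?_⟩,
    fun l h₁ h₂ j hj => ⟨?_, ?_⟩, fun r i h => ?_⟩, fun i => ?_⟩
  · rw [hval r i (by omega) h₁ h₂ h₃]; exact hz.2 _
  · rw [hval _ j (by omega) (by omega) (by omega) (by omega),
      hval _ j (by omega) (by omega) (by omega) (by omega)]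
  · rw [hval _ j (by omega) (by omega) (by omega) (by omega),
      hval _ (j + 1) (by omega) (by omega) (by omega) (by omega)]
    exact hz.1 (by simp)
  · rw [hval _ j (by omega) (by omega) (by omega) (by omega),
      hval _ j (by omega) (by omega) (by omega) (by omega)]
  · rw [hval _ j (by omega) (by omega) (by omega) (by omega),
      hval _ (j + 1) (by omega) (by omega) (by omega) (by omega)]
    exact hz.1 (by simp)
  · simp [initialPattern, h]
  · exact hval _ _ i.2 hn le_rfl (by omega)

lemma wSymp_pos {q : ℕ → ℝ} (hq : ∀ i, 0 < q i) (n : ℕ) (p : ℕ → ℕ → ℤ) : 0 < wSymp n q p :=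
  Finset.prod_pos fun _ _ => zpow_pos (hq _) _

lemma finsum_wSymp_pos {q : ℕ → ℝ} (hq : ∀ i, 0 < q i) {n k : ℕ} (hn : 1 ≤ n)
    (hk : (n + 1) / 2 = k) {z : Fin k → ℤ} (hz : W0 z) :
    0 < ∑ᶠ p ∈ {p : ℕ → ℕ → ℤ | IsSymp n p ∧ ∀ i : Fin k, p n i = z i}, wSymp n q p := by
  rw [finsum_mem_eq_finite_toFinset_sum _ (finite_symp hk z)]
  refine Finset.sum_pos (fun p _ => wSymp_pos hq n p) ?_
  simpa using nonempty_symp hn hk hz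

lemma SpOdd_pos {q : ℕ → ℝ} (hq : ∀ i, 0 < q i) {m : ℕ} {z : Fin (m + 1) → ℤ} (hz : W0 z) :
    0 < SpOdd (m + 1) q z :=
  finsum_wSymp_pos hq (by omega) (by omega) hz

lemma SpEven_pos {q : ℕ → ℝ} (hq : ∀ i, 0 < q i) {m : ℕ} {z : Fin (m + 1) → ℤ} (hz : W0 z) :
    0 < SpEven (m + 1) q z :=
  finsum_wSymp_pos hq (by omega) (by omega) hz

lemma vsum_add_single {n : ℕ} (x : Fin n → ℤ) (i : Fin n) :
    vsum (x + Pi.single i 1) = vsum x + 1 := by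
  simp [vsum, Finset.sum_add_distrib]

lemma vsum_sub_single {n : ℕ} (x : Fin n → ℤ) (i : Fin n) :
    vsum (x - Pi.single i 1) = vsum x - 1 := by
  simp [vsum, Finset.sum_sub_distrib]

lemma single_one_inj {n : ℕ} {i j : Fin n} :
    (Pi.single i 1 : Fin n → ℤ) = Pi.single j 1 ↔ i = j := by
  refine ⟨fun h => ?_, fun h => h ▸ rfl⟩
  by_contra hij
  simpa [Pi.single_apply, hij] using congrFun h i

lemma precEq_iff {m : ℕ} {x y : Fin (m + 1) → ℤ} :
    PrecEq x y ↔ (∀ i, x i ≤ y i) ∧ ∀ i : Fin m, y i.castSucc ≤ x i.succ :=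
  and_congr_right fun _ =>
    ⟨fun h i => h i (Nat.succ_lt_succ i.2), fun h i hi => h ⟨i, Nat.lt_of_succ_lt_succ hi⟩⟩

lemma w0_and_precEq_iff {m : ℕ} {x y : Fin (m + 1) → ℤ} :
    W0 x ∧ PrecEq x y ↔
      0 ≤ x 0 ∧ (∀ i, x i ≤ y i) ∧ ∀ i : Fin m, y i.castSucc ≤ x i.succ := by
  rw [precEq_iff]
  refine ⟨fun h => ⟨h.1.2 0, h.2⟩, fun h => ⟨?_, h.2⟩⟩
  have hmono : Monotone x :=
    Fin.monotone_iff_le_succ.2 fun i => (h.2.1 _).trans (h.2.2 i)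
  exact ⟨hmono, fun i => h.1.trans (hmono (Fin.zero_le i))⟩

lemma finsum_eq_neighbors {n : ℕ} (g : (Fin n → ℤ) → ℝ) (x' : Fin n → ℤ)
    (hg : ∀ x, x' ≠ x → (∀ j, x' ≠ x + Pi.single j 1) → (∀ j, x' ≠ x - Pi.single j 1) → g x = 0) :
    ∑ᶠ x, g x =
      g x' + ∑ j, g (x' - Pi.single j 1) + ∑ j, g (x' + Pi.single j 1) := by
  classical
  let D := Finset.univ.image fun j : Fin n => x' - Pi.single j (1 : ℤ)
  let U := Finset.univ.image fun j : Fin n => x' + Pi.single j (1 : ℤ)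
  have h₁ : Disjoint {x'} D := by
    rw [Finset.disjoint_singleton_left]
    intro h
    obtain ⟨j, -, h⟩ := Finset.mem_image.1 h
    have := congrArg vsum h
    rw [vsum_sub_single] at this
    omega
  have h₂ : Disjoint ({x'} ∪ D) U := by
    rw [Finset.disjoint_right]
    intro x hx hx'
    obtain ⟨j, -, rfl⟩ := Finset.mem_image.1 hx
    rcases Finset.mem_union.1 hx' with h | h
    · have := congrArg vsum (Finset.mem_singleton.1 h)
      rw [vsum_add_single] at this
      omega
    · obtain ⟨i, -, h⟩ := Finset.mem_image.1 h
      have := congrArg vsum h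
      rw [vsum_add_single, vsum_sub_single] at this
      omega
  have hs : Function.support g ⊆ ↑({x'} ∪ D ∪ U) := by
    intro x hx
    by_contra hn
    refine hx (hg x ?_ ?_ ?_)
    · rintro rfl
      exact hn (by simp)
    · rintro j rfl
      exact hn (by simp [D, sub_eq_iff_eq_add, single_one_inj])
    · rintro j rfl
      exact hn (by simp [U, ← eq_sub_iff_add_eq, single_one_inj])
  rw [finsum_eq_sum_of_support_subset g hs, Finset.sum_union h₂, Finset.sum_union h₁,
    Finset.sum_singleton, Finset.sum_image, Finset.sum_image]
  · intro i _ j _ h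
    exact single_one_inj.1 (add_left_cancel h)
  · intro i _ j _ h
    exact single_one_inj.1 (sub_right_injective h)

lemma mOE_mul_Qodd {m : ℕ} {q : ℕ → ℝ} (hq : ∀ i, 0 < q i) {x x' : Fin (m + 1) → ℤ}
    (y : Fin (m + 1) → ℤ) (hx : W0 x) (hx' : W0 x')
    (h : ∃ i, x' = x + Pi.single i 1 ∨ x' = x - Pi.single i 1) :
    mOE m q x y * Qodd m q x x' = q m ^ (vsum x - vsum x') * mOE m q x' y := by
  have hne : x' ≠ x := by
    rintro rfl
    obtain ⟨i, h | h⟩ := h <;> have := congrArg vsum h <;>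
      simp only [vsum_add_single, vsum_sub_single] at this <;> omega
  have hS := (SpOdd_pos hq hx).ne'
  rw [Qodd, if_neg hne, if_pos ⟨h, hx'⟩, mOE, mOE,
    show vsum x - vsum y = (vsum x - vsum x') + (vsum x' - vsum y) by ring, zpow_add₀ (hq m).ne']
  field_simp

lemma add_single_ne_sub_single {n : ℕ} (x : Fin n → ℤ) (i j : Fin n) :
    x + Pi.single i 1 ≠ x - Pi.single j 1 := by
  intro h
  have := congrArg vsum h
  rw [vsum_add_single, vsum_sub_single] at this
  omega

section Rates

variable (m : ℕ) (q : ℕ → ℝ) (x y : Fin (m + 1) → ℤ) (i j : Fin (m + 1))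

lemma A0oe_add_self : A0oe m q x y (x + Pi.single i 1) y = Qodd m q x (x + Pi.single i 1) := by
  simp [A0oe, single_one_inj]

lemma A0oe_sub_self : A0oe m q x y (x - Pi.single i 1) y = Qodd m q x (x - Pi.single i 1) := by
  simp [A0oe, single_one_inj]

lemma A0oe_self_add : A0oe m q x y x (y + Pi.single j 1) = (q m)⁻¹ := by
  simp [A0oe, add_single_ne_sub_single, single_one_inj]

lemma A0oe_self_sub : A0oe m q x y x (y - Pi.single j 1) = q m := by
  simp [A0oe, eq_comm (a := x), (add_single_ne_sub_single _ _ _).symm, single_one_inj]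

lemma A0oe_add_add : A0oe m q x y (x + Pi.single i 1) (y + Pi.single j 1) =
    if i = j ∧ x j = y j then Qodd m q x (x + Pi.single i 1) else 0 := by
  rcases eq_or_ne i j with rfl | h
  · simp [A0oe, add_single_ne_sub_single, single_one_inj]
  · simp [A0oe, add_single_ne_sub_single, single_one_inj, h, h.symm]

lemma A0oe_sub_add : A0oe m q x y (x - Pi.single i 1) (y + Pi.single j 1) = 0 := by
  simp [A0oe, add_single_ne_sub_single, (add_single_ne_sub_single _ _ _).symm]

lemma A0oe_add_sub : A0oe m q x y (x + Pi.single i 1) (y - Pi.single j 1) = 0 := by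
  simp [A0oe, add_single_ne_sub_single, (add_single_ne_sub_single _ _ _).symm]

lemma A0oe_sub_sub : A0oe m q x y (x - Pi.single i 1) (y - Pi.single j 1) =
    if ∃ k : Fin m, i = k.succ ∧ j = k.castSucc ∧ x k.succ = y k.castSucc
    then Qodd m q x (x - Pi.single i 1) else 0 := by
  simp [A0oe, (add_single_ne_sub_single _ _ _).symm, single_one_inj]

variable {m x y}

lemma A0oe_eq_zero_of_row_even {x' y' : Fin (m + 1) → ℤ} (h : y' ≠ y)
    (hadd : ∀ j, y' ≠ y + Pi.single j 1) (hsub : ∀ j, y' ≠ y - Pi.single j 1) :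
    A0oe m q x y x' y' = 0 := by
  simp [A0oe, h, hadd, hsub]

lemma A0oe_eq_zero_of_row_odd {x' y' : Fin (m + 1) → ℤ} (h : x' ≠ x)
    (hadd : ∀ j, x' ≠ x + Pi.single j 1) (hsub : ∀ j, x' ≠ x - Pi.single j 1) :
    A0oe m q x y x' y' = 0 := by
  simp [A0oe, h, hadd, hsub]

end Rates

section Sources

variable {m : ℕ} {x y : Fin (m + 1) → ℤ}

lemma source_sub_iff (hx : W0 x) (h : PrecEq x y) (j : Fin (m + 1)) :
    (W0 (x - Pi.single j 1) ∧ PrecEq (x - Pi.single j 1) y) ↔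
      Fin.cases (0 < x 0) (fun i => y i.castSucc < x i.succ) j := by
  rw [w0_and_precEq_iff]
  obtain ⟨h₀, h₁, h₂⟩ := w0_and_precEq_iff.1 ⟨hx, h⟩
  have h₃ : ∀ i, (x - Pi.single j 1 : Fin (m + 1) → ℤ) i ≤ y i := fun i => by
    have := h₁ i
    simp only [Pi.sub_apply, Pi.single_apply]
    split_ifs <;> omega
  induction j using Fin.cases with
  | zero =>
    refine ⟨fun h => ?_, fun h => ⟨?_, h₃, fun i => ?_⟩⟩
    · have := h.1
      simp only [Pi.sub_apply, Pi.single_eq_same] at this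
      simp only [Fin.cases_zero]
      omega
    · simp only [Fin.cases_zero] at h
      simp only [Pi.sub_apply, Pi.single_eq_same]
      omega
    · simpa [Pi.single_apply] using h₂ i
  | succ k =>
    refine ⟨fun h => ?_, fun h => ⟨?_, h₃, fun i => ?_⟩⟩
    · have := h.2.2 k
      simp only [Pi.sub_apply, Pi.single_eq_same] at this
      simp only [Fin.cases_succ]
      omega
    · simpa [Pi.single_apply, (Fin.succ_ne_zero k).symm] using h₀
    · simp only [Fin.cases_succ] at h
      simp only [Pi.sub_apply, Pi.single_apply, Fin.succ_inj]
      have := h₂ i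
      split_ifs with hik
      · subst hik
        omega
      · omega

lemma source_add_iff (hx : W0 x) (h : PrecEq x y) (j : Fin (m + 1)) :
    (W0 (x + Pi.single j 1) ∧ PrecEq (x + Pi.single j 1) y) ↔ x j < y j := by
  rw [w0_and_precEq_iff]
  obtain ⟨h₀, h₁, h₂⟩ := w0_and_precEq_iff.1 ⟨hx, h⟩
  have hle : ∀ i, x i ≤ (x + Pi.single j 1 : Fin (m + 1) → ℤ) i := fun i => by
    simp only [Pi.add_apply, Pi.single_apply]
    split_ifs <;> omega
  refine ⟨fun h => ?_, fun h => ⟨h₀.trans (hle 0), fun i => ?_, fun i => (h₂ i).trans (hle _)⟩⟩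
  · have := h.2.1 j
    simp only [Pi.add_apply, Pi.single_eq_same] at this
    omega
  · have := h₁ i
    simp only [Pi.add_apply, Pi.single_apply]
    split_ifs with hij
    · subst hij
      omega
    · omega

end Sources

section Transitions

variable {m : ℕ} {q : ℕ → ℝ} {x' y y' : Fin (m + 1) → ℤ}

open Classical in
/-- The summand of `Λ A₀`, extended by zero outside the admissible states. -/
def flow (m : ℕ) (q : ℕ → ℝ) (y x' y' x : Fin (m + 1) → ℤ) : ℝ :=
  if W0 x ∧ PrecEq x y then mOE m q x y * A0oe m q x y x' y' else 0

lemma finsum_mem_eq_flow :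
    ∑ᶠ x ∈ {x : Fin (m + 1) → ℤ | W0 x ∧ PrecEq x y}, mOE m q x y * A0oe m q x y x' y' =
      flow m q y x' y' x' + ∑ j, flow m q y x' y' (x' - Pi.single j 1) +
        ∑ j, flow m q y x' y' (x' + Pi.single j 1) := by
  rw [← finsum_eq_neighbors (flow m q y x' y') x', finsum_mem_def]
  · refine finsum_congr fun x => ?_
    by_cases h : W0 x ∧ PrecEq x y
    · rw [Set.indicator_of_mem (by exact h), flow, if_pos h]
    · rw [Set.indicator_of_notMem (by exact h), flow, if_neg h]
  · intro x h hadd hsub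
    rw [flow, A0oe_eq_zero_of_row_odd q h hadd hsub, mul_zero, ite_self]

lemma mOE_mul_Qodd_sub (hq : ∀ i, 0 < q i) (hx' : W0 x') {j : Fin (m + 1)}
    (h : W0 (x' - Pi.single j 1)) :
    mOE m q (x' - Pi.single j 1) y * Qodd m q (x' - Pi.single j 1) x' =
      (q m)⁻¹ * mOE m q x' y := by
  rw [mOE_mul_Qodd hq y h hx' ⟨j, Or.inl (sub_add_cancel _ _).symm⟩, vsum_sub_single,
    show vsum x' - 1 - vsum x' = -1 by ring, zpow_neg_one]

lemma mOE_mul_Qodd_add (hq : ∀ i, 0 < q i) (hx' : W0 x') {j : Fin (m + 1)}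
    (h : W0 (x' + Pi.single j 1)) :
    mOE m q (x' + Pi.single j 1) y * Qodd m q (x' + Pi.single j 1) x' =
      q m * mOE m q x' y := by
  rw [mOE_mul_Qodd hq y h hx' ⟨j, Or.inr (add_sub_cancel_right _ _).symm⟩, vsum_add_single,
    show vsum x' + 1 - vsum x' = 1 by ring, zpow_one]

lemma Qeven_mul_mOE (hq : ∀ i, 0 < q i) (hy' : W0 y')
    (h : ∃ j, y' = y + Pi.single j 1 ∨ y' = y - Pi.single j 1) :
    Qeven m q y y' * mOE m q x' y' = q m ^ (vsum y - vsum y') * mOE m q x' y := by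
  have hne : y' ≠ y := by
    rintro rfl
    obtain ⟨i, h | h⟩ := h <;> have := congrArg vsum h <;>
      simp only [vsum_add_single, vsum_sub_single] at this <;> omega
  have hS := (SpEven_pos hq hy').ne'
  rw [Qeven, if_neg hne, if_pos ⟨h, hy'⟩, mOE, mOE,
    show vsum x' - vsum y' = (vsum y - vsum y') + (vsum x' - vsum y) by ring, zpow_add₀ (hq m).ne']
  field_simp

lemma intertwining_self (hq : ∀ i, 0 < q i) (hx' : W0 x') (h : PrecEq x' y) :
    Qeven m q y y * mOE m q x' y =
      ∑ᶠ x ∈ {x : Fin (m + 1) → ℤ | W0 x ∧ PrecEq x y}, mOE m q x y * A0oe m q x y x' y := by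
  have hsub : ∀ j, flow m q y x' y (x' - Pi.single j 1) =
      (q m)⁻¹ * mOE m q x' y * Fin.cases (if 0 < x' 0 then 1 else 0)
        (fun i => if y i.castSucc < x' i.succ then 1 else 0) j := by
    intro j
    have hsrc := source_sub_iff hx' h j
    have hA := A0oe_add_self m q (x' - Pi.single j 1) y j
    rw [sub_add_cancel] at hA
    rw [flow, hA]
    by_cases hj : W0 (x' - Pi.single j 1) ∧ PrecEq (x' - Pi.single j 1) y
    · rw [if_pos hj, mOE_mul_Qodd_sub hq hx' hj.1]
      have := hsrc.1 hj
      induction j using Fin.cases with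
      | zero => simp only [Fin.cases_zero] at this ⊢; rw [if_pos this, mul_one]
      | succ i => simp only [Fin.cases_succ] at this ⊢; rw [if_pos this, mul_one]
    · rw [if_neg hj]
      have := mt hsrc.2 hj
      induction j using Fin.cases with
      | zero => simp only [Fin.cases_zero] at this ⊢; rw [if_neg this, mul_zero]
      | succ i => simp only [Fin.cases_succ] at this ⊢; rw [if_neg this, mul_zero]
  have hadd : ∀ j, flow m q y x' y (x' + Pi.single j 1) =
      q m * mOE m q x' y * if x' j < y j then 1 else 0 := by
    intro j
    have hA := A0oe_sub_self m q (x' + Pi.single j 1) y j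
    rw [add_sub_cancel_right] at hA
    rw [flow, hA]
    by_cases hj : W0 (x' + Pi.single j 1) ∧ PrecEq (x' + Pi.single j 1) y
    · rw [if_pos hj, if_pos ((source_add_iff hx' h j).1 hj), mOE_mul_Qodd_add hq hx' hj.1, mul_one]
    · rw [if_neg hj, if_neg (mt (source_add_iff hx' h j).2 hj), mul_zero]
  rw [finsum_mem_eq_flow, Finset.sum_congr rfl fun j _ => hsub j,
    Finset.sum_congr rfl fun j _ => hadd j, ← Finset.mul_sum, ← Finset.mul_sum, Fin.sum_univ_succ,
    Fin.sum_univ_castSucc, flow, if_pos ⟨hx', h⟩, A0oe, if_pos ⟨rfl, rfl⟩, Qeven, if_pos rfl,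
    Finset.sum_range_succ, Finset.sum_add_distrib (s := (Finset.univ : Finset (Fin m))),
    ← Finset.mul_sum, ← Finset.mul_sum]
  simp only [Fin.cases_zero, Fin.cases_succ]
  ring

lemma intertwining_add (hq : ∀ i, 0 < q i) (hy : W0 y) (hx' : W0 x') (j : Fin (m + 1))
    (hy' : W0 (y + Pi.single j 1)) (h : PrecEq x' (y + Pi.single j 1)) :
    Qeven m q y (y + Pi.single j 1) * mOE m q x' (y + Pi.single j 1) =
      ∑ᶠ x ∈ {x : Fin (m + 1) → ℤ | W0 x ∧ PrecEq x y},
        mOE m q x y * A0oe m q x y x' (y + Pi.single j 1) := by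
  obtain ⟨h₀, h₁, h₂⟩ := w0_and_precEq_iff.1 ⟨hx', h⟩
  have hle : ∀ i, y i ≤ (y + Pi.single j 1 : Fin (m + 1) → ℤ) i := fun i => by
    simp only [Pi.add_apply, Pi.single_apply]
    split_ifs <;> omega
  have h₁' : ∀ i, i ≠ j → x' i ≤ y i := fun i hi => by simpa [hi] using h₁ i
  have hj : x' j ≤ y j + 1 := by simpa using h₁ j
  have hA : ∀ i, A0oe m q (x' - Pi.single i 1) y x' (y + Pi.single j 1) =
      if i = j ∧ (x' - Pi.single i 1 : Fin (m + 1) → ℤ) j = y j then Qodd m q (x' - Pi.single i 1) x' else 0 := by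
    intro i
    have := A0oe_add_add m q (x' - Pi.single i 1) y i j
    rwa [sub_add_cancel] at this
  have hadd : ∀ i, flow m q y x' (y + Pi.single j 1) (x' + Pi.single i 1) = 0 := by
    intro i
    have := A0oe_sub_add m q (x' + Pi.single i 1) y i j
    rw [add_sub_cancel_right] at this
    rw [flow, this, mul_zero, ite_self]
  rw [Qeven_mul_mOE hq hy' ⟨j, Or.inl rfl⟩, vsum_add_single,
    show vsum y - (vsum y + 1) = -1 by ring, zpow_neg_one, finsum_mem_eq_flow,
    Finset.sum_eq_zero (fun i _ => hadd i), add_zero]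
  by_cases hlt : x' j ≤ y j
  · have hS : W0 x' ∧ PrecEq x' y := by
      refine w0_and_precEq_iff.2 ⟨h₀, fun i => ?_, fun i => (hle _).trans (h₂ i)⟩
      by_cases hi : i = j
      · exact hi ▸ hlt
      · exact h₁' i hi
    rw [Finset.sum_eq_zero, flow, if_pos hS, A0oe_self_add, add_zero, mul_comm]
    intro i _
    have : ¬ (i = j ∧ (x' - Pi.single i 1 : Fin (m + 1) → ℤ) j = y j) := by
      rintro ⟨rfl, h⟩
      simp only [Pi.sub_apply, Pi.single_eq_same] at h
      omega
    rw [flow, (hA i).trans (if_neg this), mul_zero, ite_self]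
  · have hS : ¬ (W0 x' ∧ PrecEq x' y) := fun h => hlt (h.2.1 j)
    rw [Finset.sum_eq_single j]
    · have hsrc : W0 (x' - Pi.single j 1) ∧ PrecEq (x' - Pi.single j 1) y := by
        refine w0_and_precEq_iff.2 ⟨?_, fun i => ?_, fun i => ?_⟩
        · by_cases h : 0 = j
          · have := hy.2 j
            subst h
            simp only [Pi.sub_apply, Pi.single_eq_same]
            omega
          · simpa [Pi.single_apply, h] using h₀
        · by_cases hi : i = j
          · subst hi
            simp only [Pi.sub_apply, Pi.single_eq_same]
            omega
          · simpa [Pi.single_apply, hi] using h₁' i hi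
        · by_cases hi : i.succ = j
          · subst hi
            have := hy.1 (Fin.castSucc_lt_succ (i := i)).le
            simp only [Pi.sub_apply, Pi.single_eq_same]
            omega
          · simpa [Pi.single_apply, hi] using (hle _).trans (h₂ i)
      have hval : (x' - Pi.single j 1 : Fin (m + 1) → ℤ) j = y j := by
        simp only [Pi.sub_apply, Pi.single_eq_same]
        omega
      rw [flow, if_neg hS, flow, if_pos hsrc, hA, if_pos ⟨rfl, hval⟩,
        mOE_mul_Qodd_sub hq hx' hsrc.1, zero_add]
    · intro i _ hi
      rw [flow, (hA i).trans (if_neg fun h => hi h.1), mul_zero, ite_self]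
    · simp

lemma intertwining_sub (hq : ∀ i, 0 < q i) (hy : W0 y) (hx' : W0 x') (j : Fin (m + 1))
    (hy' : W0 (y - Pi.single j 1)) (h : PrecEq x' (y - Pi.single j 1)) :
    Qeven m q y (y - Pi.single j 1) * mOE m q x' (y - Pi.single j 1) =
      ∑ᶠ x ∈ {x : Fin (m + 1) → ℤ | W0 x ∧ PrecEq x y},
        mOE m q x y * A0oe m q x y x' (y - Pi.single j 1) := by
  obtain ⟨h₀, h₁, h₂⟩ := w0_and_precEq_iff.1 ⟨hx', h⟩
  have hle : ∀ i, (y - Pi.single j 1 : Fin (m + 1) → ℤ) i ≤ y i := fun i => by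
    simp only [Pi.sub_apply, Pi.single_apply]
    split_ifs <;> omega
  have h₁' : ∀ i, x' i ≤ y i := fun i => (h₁ i).trans (hle i)
  have h₂' : ∀ i : Fin m, i.castSucc ≠ j → y i.castSucc ≤ x' i.succ := fun i hi => by
    simpa [hi] using h₂ i
  have hA : ∀ i, A0oe m q (x' + Pi.single i 1) y x' (y - Pi.single j 1) =
      if ∃ k : Fin m, i = k.succ ∧ j = k.castSucc ∧ (x' + Pi.single i 1 : Fin (m + 1) → ℤ) k.succ = y k.castSucc
      then Qodd m q (x' + Pi.single i 1) x' else 0 := by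
    intro i
    have := A0oe_sub_sub m q (x' + Pi.single i 1) y i j
    rwa [add_sub_cancel_right] at this
  have hsub : ∀ i, flow m q y x' (y - Pi.single j 1) (x' - Pi.single i 1) = 0 := by
    intro i
    have := A0oe_add_sub m q (x' - Pi.single i 1) y i j
    rw [sub_add_cancel] at this
    rw [flow, this, mul_zero, ite_self]
  rw [Qeven_mul_mOE hq hy' ⟨j, Or.inr rfl⟩, vsum_sub_single,
    show vsum y - (vsum y - 1) = 1 by ring, zpow_one, finsum_mem_eq_flow,
    Finset.sum_eq_zero (fun i _ => hsub i), add_zero]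
  by_cases hS : W0 x' ∧ PrecEq x' y
  · rw [Finset.sum_eq_zero, flow, if_pos hS, A0oe_self_sub, add_zero, mul_comm]
    intro i _
    rw [flow, (hA i).trans (if_neg ?_), mul_zero, ite_self]
    rintro ⟨k, rfl, rfl, hk⟩
    have := (precEq_iff.1 hS.2).2 k
    simp only [Pi.add_apply, Pi.single_eq_same] at hk
    omega
  · obtain ⟨k, rfl, hk⟩ : ∃ k : Fin m, j = k.castSucc ∧ x' k.succ < y k.castSucc := by
      by_contra! hcon
      refine hS (w0_and_precEq_iff.2 ⟨h₀, h₁', fun i => ?_⟩)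
      by_cases hi : i.castSucc = j
      · exact hcon i hi.symm
      · exact h₂' i hi
    have hk' := h₂ k
    simp only [Pi.sub_apply, Pi.single_eq_same] at hk'
    have hle' : ∀ i, x' i ≤ (x' + Pi.single k.succ 1 : Fin (m + 1) → ℤ) i := fun i => by
      simp only [Pi.add_apply, Pi.single_apply]
      split_ifs <;> omega
    have hval : (x' + Pi.single k.succ 1 : Fin (m + 1) → ℤ) k.succ = y k.castSucc := by
      simp only [Pi.add_apply, Pi.single_eq_same]
      omega
    rw [Finset.sum_eq_single k.succ]
    · have hsrc : W0 (x' + Pi.single k.succ 1) ∧ PrecEq (x' + Pi.single k.succ 1) y := by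
        refine w0_and_precEq_iff.2 ⟨h₀.trans (hle' 0), fun i => ?_, fun i => ?_⟩
        · by_cases hi : i = k.succ
          · rw [hi, hval]
            exact hy.1 (Fin.castSucc_lt_succ (i := k)).le
          · simpa [Pi.single_apply, hi] using h₁' i
        · by_cases hi : i = k
          · rw [hi, hval]
          · exact (h₂' i (by simpa using hi)).trans (hle' _)
      rw [flow, if_neg hS, flow, if_pos hsrc, hA, if_pos ⟨k, rfl, rfl, hval⟩,
        mOE_mul_Qodd_add hq hx' hsrc.1, zero_add]
    · intro i _ hi
      rw [flow, (hA i).trans (if_neg ?_), mul_zero, ite_self]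
      rintro ⟨l, rfl, hl, -⟩
      exact hi (by rw [Fin.castSucc_injective _ hl])
    · simp

end Transitions

/-- Intertwining with a wall, odd row to even row: `Q_{2n} Λ = Λ A₀`, i.e.
`Q_{2n}(y,y′)·m(x′,y′) = Σ_{x ∈ W₀^n, x ≺ y} m(x,y)·A₀((x,y),(x′,y′))` (here `n = m+1`). -/
theorem wall_intertwining_odd_to_even (m : ℕ) (q : ℕ → ℝ)
    (hq : ∀ i, 0 < q i ∧ q i < 1)
    (y : Fin (m + 1) → ℤ) (hy : W0 y)
    (x' y' : Fin (m + 1) → ℤ) (hx' : W0 x') (hy' : W0 y') (hxy' : PrecEq x' y') :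
    Qeven m q y y' * mOE m q x' y' =
      ∑ᶠ x ∈ {x : Fin (m + 1) → ℤ | W0 x ∧ PrecEq x y},
        mOE m q x y * A0oe m q x y x' y' := by
  have hq' : ∀ i, 0 < q i := fun i => (hq i).1
  by_cases h : y' = y
  · subst h
    exact intertwining_self hq' hx' hxy'
  by_cases hadd : ∃ j, y' = y + Pi.single j 1
  · obtain ⟨j, rfl⟩ := hadd
    exact intertwining_add hq' hy hx' j hy' hxy'
  by_cases hsub : ∃ j, y' = y - Pi.single j 1
  · obtain ⟨j, rfl⟩ := hsub
    exact intertwining_sub hq' hy hx' j hy' hxy'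
  push Not at hadd hsub
  have hQ : Qeven m q y y' = 0 := by simp [Qeven, h, hadd, hsub]
  simp [hQ, A0oe_eq_zero_of_row_even q h hadd hsub]

end
end
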